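/- Let v : Ω̄×[0,T] → ℝ² be smooth. Then Σ_{l₂=0}^{1} ( Σ_{l₁=0}^{4} ‖ρ₀^{l₂}∂₁^{l₁}D^{l₂+2}v(t)‖_{L²(Ω)} + Σ_{l₁=0}^{2} ‖ρ₀^{l₂}∂₁^{l₁}D^{l₂+3}v(t)‖_{L²(Ω)} ) ≤ C E(t,v)^{1/2} and Σ_{l₁=0}^{2} ‖ρ₀³∂₁^{l₁}D⁶v(t)‖_{L²(Ω)} + Σ_{l₂=1}^{4} ‖ρ₀^{l₂}D^{l₂+4}v(t)‖_{L²(Ω)} ≤ C E(t,v)^{1/2}, with C depending only on Ω, C₁, C₂. Consequently, if η(x,t) = x + ∫₀ᵗ v(x,s) ds, the same weighted norms of η are bounded by C t sup_{0≤s≤t} E(s,v)^{1/2}. -/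

import Mathlib

open MeasureTheory Real Filter

noncomputable section

/-- The reference domain `Ω = 𝕋 × (0,1)`, realized as the fundamental square `(0,1) × (0,1)`. -/
def Oset : Set (ℝ × ℝ) := Set.Ioo (0:ℝ) 1 ×ˢ Set.Ioo (0:ℝ) 1

/-- The vacuum boundary `Γ = 𝕋 × {0,1}`. -/
def Gset : Set (ℝ × ℝ) := {x : ℝ × ℝ | x.2 = 0 ∨ x.2 = 1}

/-- Distance to the boundary `Γ`. -/
def distG (x : ℝ × ℝ) : ℝ := min x.2 (1 - x.2)

variable {F : Type*} [NormedAddCommGroup F] [NormedSpace ℝ F]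

/-- Horizontal partial derivative `∂₁`. -/
def pd1 (f : ℝ × ℝ → F) : ℝ × ℝ → F := fun x => fderiv ℝ f x (1, 0)

/-- Vertical (normal) partial derivative `∂₂`. -/
def pd2 (f : ℝ × ℝ → F) : ℝ × ℝ → F := fun x => fderiv ℝ f x (0, 1)

/-- Time derivative `∂ₜ`. -/
def pdt (v : ℝ → ℝ × ℝ → F) : ℝ → ℝ × ℝ → F := fun t x => deriv (fun s => v s x) t

/-- `|Df|²` at a point. -/
def gradSq (f : ℝ × ℝ → F) (x : ℝ × ℝ) : ℝ := ‖pd1 f x‖ ^ 2 + ‖pd2 f x‖ ^ 2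

/-- 1-periodicity in the horizontal variable (functions on the torus `𝕋 × (0,1)`). -/
def Per (f : ℝ × ℝ → F) : Prop := ∀ x : ℝ × ℝ, f (x.1 + 1, x.2) = f x

/-- Smoothness. -/
def SmoothFn (f : ℝ × ℝ → F) : Prop := ∀ n : ℕ, ContDiff ℝ n f

/-- Joint smoothness of a time dependent family. -/
def SmoothT (v : ℝ → ℝ × ℝ → F) : Prop :=
  ∀ n : ℕ, ContDiff ℝ n (fun p : ℝ × (ℝ × ℝ) => v p.1 p.2)

def PerT (v : ℝ → ℝ × ℝ → F) : Prop := ∀ t : ℝ, Per (v t)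

/-- Admissible initial depth profile: smooth, periodic, vanishing on `Γ` and
comparable to the distance to the boundary. -/
def IsDensity (C₁ C₂ : ℝ) (ρ₀ : ℝ × ℝ → ℝ) : Prop :=
  SmoothFn ρ₀ ∧ Per ρ₀ ∧ (∀ x ∈ Gset, ρ₀ x = 0) ∧
    ∀ x ∈ Oset, C₁ * distG x ≤ ρ₀ x ∧ ρ₀ x ≤ C₂ * distG x

/-- The higher-order energy functional `E(t,v)`. -/
def energy (ρ₀ : ℝ × ℝ → ℝ) (v : ℝ → ℝ × ℝ → ℝ × ℝ) (t : ℝ) : ℝ :=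
  (∑ l₀ ∈ Finset.range 5, ∫ x in Oset, ρ₀ x * ‖(pdt^[l₀] v) t x‖ ^ 2)
    + (∑ l₀ ∈ Finset.range 4, ∑ l₁ ∈ Finset.range (7 - 2 * l₀),
        ∫ x in Oset, ρ₀ x *
          (gradSq (pd1^[l₁] ((pdt^[l₀] v) t)) x + gradSq (pd1^[l₁ + 1] ((pdt^[l₀] v) t)) x))
    + ∑ l₀ ∈ Finset.range 4, ∑ l₁ ∈ Finset.range (7 - 2 * l₀),
        ∑ l₂ ∈ Finset.Icc 2 (8 - 2 * l₀ - l₁),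
          ∫ x in Oset, ρ₀ x ^ l₂ * ‖(pd1^[l₁] (pd2^[l₂] ((pdt^[l₀] v) t))) x‖ ^ 2

/-- The Lagrangian flow map `η(x,t) = x + ∫₀ᵗ v(x,s) ds`. -/
def flowMap (v : ℝ → ℝ × ℝ → ℝ × ℝ) (t : ℝ) (x : ℝ × ℝ) : ℝ × ℝ :=
  x + ∫ s in (0:ℝ)..t, v s x

/-- The (squared-sum) Sobolev `H^k(Ω)` norm. -/
def sobolevNorm (k : ℕ) (f : ℝ × ℝ → F) : ℝ :=
  Real.sqrt (∑ θ ∈ Finset.range (k + 1), ∫ x in Oset, ‖iteratedFDeriv ℝ θ f x‖ ^ 2)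

/-- `sup_{0 ≤ s ≤ t} E(s,v)^{1/2}`. -/
def supEn (ρ₀ : ℝ × ℝ → ℝ) (v : ℝ → ℝ × ℝ → ℝ × ℝ) (t : ℝ) : ℝ :=
  ⨆ s : Set.Icc (0:ℝ) t, Real.sqrt (energy ρ₀ v ↑s)

/-- Weighted `L²(Ω)` norm `‖ρ₀^p ∂₁^{l₁} D^k f‖_{L²(Ω)}`. -/
def wL2 (ρ₀ : ℝ × ℝ → ℝ) (p k l₁ : ℕ) (f : ℝ × ℝ → F) : ℝ :=
  Real.sqrt (∫ x in Oset, (ρ₀ x ^ p * ‖iteratedFDeriv ℝ k (pd1^[l₁] f) x‖) ^ 2)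

/-- Weighted `L^∞(Ω)` norm `‖ρ₀^p ∂₁^{l₁} D^k f‖_{L^∞(Ω)}`. -/
def wSup (ρ₀ : ℝ × ℝ → ℝ) (p k l₁ : ℕ) (f : ℝ × ℝ → F) : ℝ :=
  ⨆ x : Oset, ρ₀ (x : ℝ × ℝ) ^ p * ‖iteratedFDeriv ℝ k (pd1^[l₁] f) (x : ℝ × ℝ)‖

def pick (i : Fin 2) (w : ℝ × ℝ) : ℝ := if i = 0 then w.1 else w.2

def evec (k : Fin 2) : ℝ × ℝ := if k = 0 then (1, 0) else (0, 1)

def pdk (k : Fin 2) (f : ℝ × ℝ → ℝ) : ℝ × ℝ → ℝ := fun x => fderiv ℝ f x (evec k)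

/-- The cofactor matrix `a` of `Dη`, `a = [[∂₂η², −∂₂η¹], [−∂₁η², ∂₁η¹]]`,
indexed so that `cof η x i k = a_i^k`. -/
def cof (η : ℝ × ℝ → ℝ × ℝ) (x : ℝ × ℝ) (i k : Fin 2) : ℝ :=
  if i = 0 then
    (if k = 0 then pd2 (fun y => (η y).2) x else -pd1 (fun y => (η y).2) x)
  else
    (if k = 0 then -pd2 (fun y => (η y).1) x else pd1 (fun y => (η y).1) x)

/-- The Jacobian determinant `J = det Dη`. -/
def jac (η : ℝ × ℝ → ℝ × ℝ) (x : ℝ × ℝ) : ℝ :=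
  pd1 (fun y => (η y).1) x * pd2 (fun y => (η y).2) x
    - pd2 (fun y => (η y).1) x * pd1 (fun y => (η y).2) x

/-- `b^{kj} = a_l^k a_l^j`. -/
def bmat (η : ℝ × ℝ → ℝ × ℝ) (x : ℝ × ℝ) (k j : Fin 2) : ℝ :=
  ∑ l : Fin 2, cof η x l k * cof η x l j

/-- `(v,η)` is a (classical) solution of the Lagrangian system
`ρ₀ ∂ₜ v^i + (ρ₀² J⁻² a_i^k),_k = (ρ₀ J⁻² b^{kj} v^i,_j),_k` in `Ω × (0,T]`. -/
def IsLagSol (ρ₀ : ℝ × ℝ → ℝ) (v : ℝ → ℝ × ℝ → ℝ × ℝ) (T : ℝ) : Prop :=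
  ∀ t : ℝ, 0 < t → t ≤ T → ∀ x ∈ Oset, ∀ i : Fin 2,
    ρ₀ x * pick i (pdt v t x)
        + ∑ k : Fin 2, pdk k
            (fun y => ρ₀ y ^ 2 * jac (flowMap v t) y ^ (-2 : ℤ) * cof (flowMap v t) y i k) x
      = ∑ k : Fin 2, pdk k
          (fun y => ρ₀ y * jac (flowMap v t) y ^ (-2 : ℤ) *
            ∑ j : Fin 2, bmat (flowMap v t) y k j * pdk j (fun z => pick i (v t z)) y) x

/-- The a priori assumption: `sup_{0≤t≤T} E(t,v) ≤ M₁`,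
`T ∈ (0, 1/(20c₁c₂√M₁ + 10c₁²c₂²M₁)] ∩ (0,1)`, where `c₁, c₂` are the constants of the
embedding inequalities, so that in particular `‖Dv‖_{L^∞} ≤ c₁c₂ E^{1/2}`. -/
def Apriori (ρ₀ : ℝ × ℝ → ℝ) (v : ℝ → ℝ × ℝ → ℝ × ℝ) (T M₁ c₁ c₂ : ℝ) : Prop :=
  0 < c₁ ∧ 0 < c₂ ∧ 0 ≤ M₁ ∧ 0 < T ∧ T ≤ 1 ∧
    T ≤ 1 / (20 * c₁ * c₂ * Real.sqrt M₁ + 10 * c₁ ^ 2 * c₂ ^ 2 * M₁) ∧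
    (∀ t ∈ Set.Icc (0:ℝ) T, energy ρ₀ v t ≤ M₁) ∧
    ∀ t ∈ Set.Icc (0:ℝ) T, ∀ x ∈ Oset,
      ‖fderiv ℝ (v t) x‖ ≤ c₁ * c₂ * Real.sqrt (energy ρ₀ v t)

/-- Smooth test functions compactly supported in `Ω`. -/
def CinfTest (φ : ℝ × ℝ → ℝ) : Prop :=
  (∀ n : ℕ, ContDiff ℝ n φ) ∧ HasCompactSupport φ ∧ tsupport φ ⊆ Oset

/-- `g` is the weak directional derivative of `u` in direction `e` on `Ω`. -/
def WeakPD (e : ℝ × ℝ) (u g : ℝ × ℝ → ℝ) : Prop :=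
  ∀ φ : ℝ × ℝ → ℝ, CinfTest φ →
    ∫ x in Oset, u x * fderiv ℝ φ x e = -∫ x in Oset, g x * φ x

/-- Membership in the weighted space `H¹_{ρ₀}(Ω)`, with weak gradient `Dw`. -/
def InH1w (ρ₀ : ℝ × ℝ → ℝ) (w : ℝ × ℝ → ℝ) (Dw : ℝ × ℝ → ℝ × ℝ) : Prop :=
  AEStronglyMeasurable w (volume.restrict Oset) ∧
    AEStronglyMeasurable Dw (volume.restrict Oset) ∧
    IntegrableOn (fun x => ρ₀ x * (w x) ^ 2) Oset ∧
    IntegrableOn (fun x => ρ₀ x * ‖Dw x‖ ^ 2) Oset ∧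
    WeakPD (1, 0) w (fun x => (Dw x).1) ∧ WeakPD (0, 1) w (fun x => (Dw x).2)

/-- The bilinear form `B[w,φ]_μ = ∫_Ω ρ₀ (Dw·Dφ + wφ) dx`. -/
def Bform (ρ₀ : ℝ × ℝ → ℝ) (w : ℝ × ℝ → ℝ) (Dw : ℝ × ℝ → ℝ × ℝ)
    (φ : ℝ × ℝ → ℝ) (Dφ : ℝ × ℝ → ℝ × ℝ) : ℝ :=
  ∫ x in Oset, ρ₀ x * ((Dw x).1 * (Dφ x).1 + (Dw x).2 * (Dφ x).2 + w x * φ x)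

open scoped ContDiff

/-! ### Calculus of the partial derivatives -/

lemma nat_le_infty (n : ℕ) : (n : WithTop ℕ∞) ≤ ∞ := by exact_mod_cast le_top

lemma sm_pd1 {f : ℝ × ℝ → ℝ × ℝ} (hf : ContDiff ℝ ∞ f) : ContDiff ℝ ∞ (pd1 f) :=
  (hf.fderiv_right (m := ∞) (by simp)).clm_apply contDiff_const

lemma sm_pd2 {f : ℝ × ℝ → ℝ × ℝ} (hf : ContDiff ℝ ∞ f) : ContDiff ℝ ∞ (pd2 f) :=
  (hf.fderiv_right (m := ∞) (by simp)).clm_apply contDiff_const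

lemma sm_pd1_it {f : ℝ × ℝ → ℝ × ℝ} (hf : ContDiff ℝ ∞ f) (i : ℕ) :
    ContDiff ℝ ∞ (pd1^[i] f) := by
  induction i with
  | zero => exact hf
  | succ i ih => rw [Function.iterate_succ_apply']; exact sm_pd1 ih

lemma sm_pd2_it {f : ℝ × ℝ → ℝ × ℝ} (hf : ContDiff ℝ ∞ f) (i : ℕ) :
    ContDiff ℝ ∞ (pd2^[i] f) := by
  induction i with
  | zero => exact hf
  | succ i ih => rw [Function.iterate_succ_apply']; exact sm_pd2 ih

lemma sm_mixed {f : ℝ × ℝ → ℝ × ℝ} (hf : ContDiff ℝ ∞ f) (i m : ℕ) :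
    ContDiff ℝ ∞ (pd1^[i] (pd2^[m] f)) := sm_pd1_it (sm_pd2_it hf m) i

lemma pd_comm {f : ℝ × ℝ → ℝ × ℝ} (hf : ContDiff ℝ ∞ f) : pd2 (pd1 f) = pd1 (pd2 f) := by
  funext x
  have hd : DifferentiableAt ℝ (fderiv ℝ f) x :=
    (hf.fderiv_right (m := ∞) (by simp)).differentiable (by simp) x
  have h1 : ∀ a b : ℝ × ℝ, fderiv ℝ (fun y => fderiv ℝ f y a) x b
      = fderiv ℝ (fderiv ℝ f) x b a := by
    intro a b
    rw [fderiv_clm_apply hd (differentiableAt_const a)]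
    simp
  have hs : IsSymmSndFDerivAt ℝ f x := by
    apply ContDiffAt.isSymmSndFDerivAt (n := ∞) hf.contDiffAt
    simp only [minSmoothness_of_isRCLikeNormedField]
    exact nat_le_infty 2
  show fderiv ℝ (fun y => fderiv ℝ f y (1, 0)) x (0, 1)
    = fderiv ℝ (fun y => fderiv ℝ f y (0, 1)) x (1, 0)
  rw [h1, h1]
  exact hs _ _

lemma pd2_pd1_it {f : ℝ × ℝ → ℝ × ℝ} (hf : ContDiff ℝ ∞ f) (i : ℕ) :
    pd2 (pd1^[i] f) = pd1^[i] (pd2 f) := by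
  induction i with
  | zero => rfl
  | succ i ih =>
    rw [Function.iterate_succ_apply', Function.iterate_succ_apply', pd_comm (sm_pd1_it hf i), ih]

lemma pd2_mixed {f : ℝ × ℝ → ℝ × ℝ} (hf : ContDiff ℝ ∞ f) (i m : ℕ) :
    pd2 (pd1^[i] (pd2^[m] f)) = pd1^[i] (pd2^[m + 1] f) := by
  rw [pd2_pd1_it (sm_pd2_it hf m), Function.iterate_succ_apply']

/-- One step in the bound of the full derivative tensor by partial derivatives. -/
lemma norm_iter_succ {f : ℝ × ℝ → ℝ × ℝ} (hf : ContDiff ℝ ∞ f) (k : ℕ) (x : ℝ × ℝ) :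
    ‖iteratedFDeriv ℝ (k + 1) f x‖
      ≤ ‖iteratedFDeriv ℝ k (pd1 f) x‖ + ‖iteratedFDeriv ℝ k (pd2 f) x‖ := by
  let L1 : (ℝ × ℝ) →L[ℝ] ((ℝ × ℝ) →L[ℝ] (ℝ × ℝ)) :=
    ContinuousLinearMap.smulRightL ℝ (ℝ × ℝ) (ℝ × ℝ) (ContinuousLinearMap.fst ℝ ℝ ℝ)
  let L2 : (ℝ × ℝ) →L[ℝ] ((ℝ × ℝ) →L[ℝ] (ℝ × ℝ)) :=
    ContinuousLinearMap.smulRightL ℝ (ℝ × ℝ) (ℝ × ℝ) (ContinuousLinearMap.snd ℝ ℝ ℝ)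
  have hL1 : ‖L1‖ ≤ 1 := by
    refine ContinuousLinearMap.opNorm_le_bound _ zero_le_one fun c => ?_
    have : ‖L1 c‖ = ‖ContinuousLinearMap.fst ℝ ℝ ℝ‖ * ‖c‖ :=
      ContinuousLinearMap.norm_smulRight_apply _ _
    rw [this]
    exact mul_le_mul_of_nonneg_right (ContinuousLinearMap.norm_fst_le ..) (norm_nonneg _)
  have hL2 : ‖L2‖ ≤ 1 := by
    refine ContinuousLinearMap.opNorm_le_bound _ zero_le_one fun c => ?_
    have : ‖L2 c‖ = ‖ContinuousLinearMap.snd ℝ ℝ ℝ‖ * ‖c‖ :=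
      ContinuousLinearMap.norm_smulRight_apply _ _
    rw [this]
    exact mul_le_mul_of_nonneg_right (ContinuousLinearMap.norm_snd_le ..) (norm_nonneg _)
  have hfd : fderiv ℝ f = (L1 ∘ pd1 f) + (L2 ∘ pd2 f) := by
    funext y
    refine ContinuousLinearMap.ext fun z => ?_
    have hz : z = z.1 • ((1:ℝ), (0:ℝ)) + z.2 • ((0:ℝ), (1:ℝ)) := by ext <;> simp
    have h2 : (fderiv ℝ f y) z = z.1 • pd1 f y + z.2 • pd2 f y := by
      conv_lhs => rw [hz]
      rw [map_add, map_smul, map_smul]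
      rfl
    exact h2
  have c1 : ContDiff ℝ k (pd1 f) := (sm_pd1 hf).of_le (by exact_mod_cast le_top)
  have c2 : ContDiff ℝ k (pd2 f) := (sm_pd2 hf).of_le (by exact_mod_cast le_top)
  rw [← norm_iteratedFDeriv_fderiv, hfd, iteratedFDeriv_add_apply
    (L1.contDiff.comp c1).contDiffAt (L2.contDiff.comp c2).contDiffAt]
  refine (norm_add_le _ _).trans (add_le_add ?_ ?_)
  · refine (L1.norm_iteratedFDeriv_comp_left c1.contDiffAt le_rfl).trans ?_
    exact mul_le_of_le_one_left (norm_nonneg _) hL1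
  · refine (L2.norm_iteratedFDeriv_comp_left c2.contDiffAt le_rfl).trans ?_
    exact mul_le_of_le_one_left (norm_nonneg _) hL2

lemma norm_iter_le {f : ℝ × ℝ → ℝ × ℝ} (hf : ContDiff ℝ ∞ f) (x : ℝ × ℝ) (B : ℝ) (k : ℕ) :
    ∀ i j : ℕ, (∀ m ≤ k, ‖pd1^[i + (k - m)] (pd2^[j + m] f) x‖ ≤ B) →
      ‖iteratedFDeriv ℝ k (pd1^[i] (pd2^[j] f)) x‖ ≤ 2 ^ k * B := by
  induction k with
  | zero =>
    intro i j h
    have := h 0 le_rfl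
    simpa using this
  | succ k ih =>
    intro i j h
    refine (norm_iter_succ (sm_mixed hf i j) k x).trans ?_
    have h1 := ih (i + 1) j (fun m hm => by
      have := h m (by omega)
      rwa [show i + (k + 1 - m) = i + 1 + (k - m) by omega] at this)
    have h2 := ih i (j + 1) (fun m hm => by
      have := h (m + 1) (by omega)
      rwa [show i + (k + 1 - (m + 1)) = i + (k - m) by omega,
        show j + (m + 1) = j + 1 + m by omega] at this)
    rw [Function.iterate_succ_apply'] at h1
    rw [pd2_mixed hf]
    rw [pow_succ]
    linarith

lemma norm_iter_sq_le {f : ℝ × ℝ → ℝ × ℝ} (hf : ContDiff ℝ ∞ f) (x : ℝ × ℝ) (k i : ℕ) :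
    ‖iteratedFDeriv ℝ k (pd1^[i] f) x‖ ^ 2
      ≤ 4 ^ k * (k + 1) * ∑ m ∈ Finset.range (k + 1), ‖pd1^[i + (k - m)] (pd2^[m] f) x‖ ^ 2 := by
  have h := norm_iter_le hf x
    (∑ m ∈ Finset.range (k + 1), ‖pd1^[i + (k - m)] (pd2^[m] f) x‖) k i 0 (fun m hm => by
      rw [zero_add]
      exact Finset.single_le_sum (f := fun m => ‖pd1^[i + (k - m)] (pd2^[m] f) x‖)
        (fun _ _ => norm_nonneg _) (Finset.mem_range.2 (by omega)))
  have h2 := pow_le_pow_left₀ (norm_nonneg _) h 2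
  have h3 := sq_sum_le_card_mul_sum_sq (s := Finset.range (k + 1))
    (f := fun m => ‖pd1^[i + (k - m)] (pd2^[m] f) x‖)
  rw [Finset.card_range] at h3
  simp only [Function.iterate_zero, id_eq] at h2
  refine h2.trans ?_
  rw [mul_pow, ← pow_mul, mul_comm k 2, pow_mul, mul_assoc]
  push_cast at h3
  norm_num
  exact h3

/-! ### Integration over the domain and the Hardy inequality -/

/-- The polynomial weight comparable to the distance. -/
def qw (x : ℝ × ℝ) : ℝ := x.2 * (1 - x.2)

lemma qw_cont : Continuous qw := by unfold qw; fun_prop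

lemma qw_nonneg {x : ℝ × ℝ} (hx : x ∈ Oset) : 0 ≤ qw x :=
  mul_nonneg hx.2.1.le (by linarith [hx.2.2])

lemma qw_le_one {x : ℝ × ℝ} (hx : x ∈ Oset) : qw x ≤ 1 := by
  have h1 := hx.2.1
  have h2 := hx.2.2
  unfold qw; nlinarith

lemma qw_le_dist {x : ℝ × ℝ} (hx : x ∈ Oset) : qw x ≤ distG x := by
  have h1 := hx.2.1
  have h2 := hx.2.2
  unfold qw distG; rw [le_min_iff]; constructor <;> nlinarith

lemma dist_le_qw {x : ℝ × ℝ} (hx : x ∈ Oset) : distG x ≤ 2 * qw x := by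
  have h1 := hx.2.1
  have h2 := hx.2.2
  unfold qw distG
  rcases le_total x.2 (1 / 2) with h | h
  · refine (min_le_left _ _).trans ?_; nlinarith
  · refine (min_le_right _ _).trans ?_; nlinarith

lemma Oset_meas : MeasurableSet Oset := measurableSet_Ioo.prod measurableSet_Ioo

lemma intO {g : ℝ × ℝ → ℝ} (hg : Continuous g) : IntegrableOn g Oset :=
  (hg.continuousOn.integrableOn_compact (isCompact_Icc.prod isCompact_Icc)).mono_set
    (Set.prod_mono Set.Ioo_subset_Icc_self Set.Ioo_subset_Icc_self)

lemma int_mono {g h : ℝ × ℝ → ℝ} (hg : Continuous g) (hh : Continuous h)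
    (hgh : ∀ x ∈ Oset, g x ≤ h x) : ∫ x in Oset, g x ≤ ∫ x in Oset, h x :=
  setIntegral_mono_on (intO hg) (intO hh) Oset_meas hgh

lemma int_nonneg {g : ℝ × ℝ → ℝ} (hg : ∀ x ∈ Oset, 0 ≤ g x) : 0 ≤ ∫ x in Oset, g x :=
  setIntegral_nonneg Oset_meas hg

lemma int_vert_deriv {G g : ℝ × ℝ → ℝ} (hg : Continuous g)
    (hG : ∀ a b : ℝ, HasDerivAt (fun y => G (a, y)) (g (a, b)) b)
    (h0 : ∀ a, G (a, 0) = 0) (h1 : ∀ a, G (a, 1) = 0) : ∫ x in Oset, g x = 0 := by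
  have hi := intO hg
  unfold Oset at hi ⊢
  rw [Measure.volume_eq_prod] at hi ⊢
  rw [setIntegral_prod _ hi]
  have : ∀ a : ℝ, ∫ y in Set.Ioo (0:ℝ) 1, g (a, y) = 0 := by
    intro a
    rw [← integral_Ioc_eq_integral_Ioo, ← intervalIntegral.integral_of_le zero_le_one,
      intervalIntegral.integral_eq_sub_of_hasDerivAt (fun y _ => hG a y)
        ((hg.comp (by fun_prop)).intervalIntegrable _ _), h0, h1, sub_zero]
  simp [this]

lemma hardy_real (a : ℕ) {f f' : ℝ × ℝ → ℝ} (hf : Continuous f) (hf' : Continuous f')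
    (hd : ∀ s b : ℝ, HasDerivAt (fun y => f (s, y)) (f' (s, b)) b) :
    ∫ x in Oset, qw x ^ a * f x ^ 2
      ≤ 2 * (4 * a + 6) ^ 2 * ∫ x in Oset, qw x ^ (a + 2) * (f x ^ 2 + f' x ^ 2) := by
  have hq := qw_cont
  set g : ℝ × ℝ → ℝ := fun x =>
    (((a:ℝ) + 1) * qw x ^ a - (4 * a + 6) * qw x ^ (a + 1)) * f x ^ 2
      + 2 * (qw x ^ (a + 1) * (1 - 2 * x.2)) * (f x * f' x) with hg
  have hgc : Continuous g := by rw [hg]; fun_prop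
  have h0 : ∫ x in Oset, g x = 0 := by
    refine int_vert_deriv (G := fun x => qw x ^ (a + 1) * (1 - 2 * x.2) * f x ^ 2) hgc ?_ ?_ ?_
    · intro s b
      have e1 : HasDerivAt (fun y : ℝ => y * (1 - y)) (1 - 2 * b) b := by
        have := (hasDerivAt_id' b).mul ((hasDerivAt_id' b).const_sub 1)
        refine this.congr_deriv ?_
        ring
      have e2 : HasDerivAt (fun y : ℝ => 1 - 2 * y) (-2) b := by
        have := ((hasDerivAt_id' b).const_mul 2).const_sub 1
        refine this.congr_deriv ?_
        ring
      have e3 := (((e1.pow (a + 1)).mul e2).mul ((hd s b).pow 2))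
      refine e3.congr_deriv ?_
      simp only [hg, qw, Pi.pow_apply, Pi.mul_apply]
      push_cast
      ring
    · intro s; simp [qw]
    · intro s; simp [qw]
  have key : ∫ x in Oset, qw x ^ a * f x ^ 2 ≤ ∫ x in Oset, (2 * g x
      + 2 * (4 * a + 6) ^ 2 * (qw x ^ (a + 2) * (f x ^ 2 + f' x ^ 2))) := by
    refine int_mono (by fun_prop) (by fun_prop) ?_
    intro x hx
    have hq0 := qw_nonneg hx
    have hQ : 0 ≤ qw x ^ a := pow_nonneg hq0 a
    have hm : |1 - 2 * x.2| ≤ 1 := by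
      have h1 := hx.2.1
      have h2 := hx.2.2
      rw [abs_le]; constructor <;> linarith
    have ha : (0:ℝ) ≤ a := Nat.cast_nonneg a
    set q := qw x
    set u := f x
    set w := f' x
    set r := 1 - 2 * x.2
    have i1 : (4 * (a:ℝ) + 6) * q * u ^ 2 ≤ u ^ 2 / 4 + (4 * a + 6) ^ 2 * q ^ 2 * u ^ 2 := by
      nlinarith [sq_nonneg ((1 / 2 - (4 * (a:ℝ) + 6) * q) * u)]
    have hr : r ^ 2 ≤ 1 := by rw [sq_le_one_iff_abs_le_one]; exact hm
    have i2 : -(2 * (q * r) * (u * w)) ≤ u ^ 2 / 4 + 4 * q ^ 2 * w ^ 2 := by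
      have := sq_nonneg (u / 2 + 2 * q * r * w)
      have h4 : (q * w) ^ 2 * r ^ 2 ≤ (q * w) ^ 2 * 1 :=
        mul_le_mul_of_nonneg_left hr (sq_nonneg _)
      nlinarith
    have i3 : 4 * q ^ 2 * w ^ 2 ≤ (4 * (a:ℝ) + 6) ^ 2 * q ^ 2 * w ^ 2 := by
      have : (4:ℝ) ≤ (4 * (a:ℝ) + 6) ^ 2 := by nlinarith
      have h5 : 0 ≤ q ^ 2 * w ^ 2 := by positivity
      nlinarith
    have i4 : u ^ 2 ≤ 2 * (((a:ℝ) + 1) * u ^ 2 - (4 * a + 6) * q * u ^ 2 + 2 * (q * r) * (u * w))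
        + 2 * (4 * a + 6) ^ 2 * (q ^ 2 * (u ^ 2 + w ^ 2)) := by
      have : 0 ≤ (a:ℝ) * u ^ 2 := by positivity
      linarith
    have i5 := mul_le_mul_of_nonneg_left i4 hQ
    refine i5.trans (le_of_eq ?_)
    simp only [hg]
    change _ = 2 * ((((a:ℝ) + 1) * q ^ a - (4 * a + 6) * q ^ (a + 1)) * u ^ 2
      + 2 * (q ^ (a + 1) * r) * (u * w)) + _
    ring
  refine key.trans (le_of_eq ?_)
  rw [integral_add (intO (by fun_prop)) (intO (by fun_prop)), integral_const_mul,
    integral_const_mul, h0]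
  ring

lemma norm_sq_le_prod (z : ℝ × ℝ) : ‖z‖ ^ 2 ≤ z.1 ^ 2 + z.2 ^ 2 := by
  rw [Prod.norm_def]
  rcases max_cases ‖z.1‖ ‖z.2‖ with h | h <;> rw [h.1, Real.norm_eq_abs, sq_abs] <;>
    nlinarith [sq_nonneg z.1, sq_nonneg z.2]

lemma fst_sq_le (z : ℝ × ℝ) : z.1 ^ 2 ≤ ‖z‖ ^ 2 := by
  rw [← sq_abs, ← Real.norm_eq_abs]
  exact pow_le_pow_left₀ (norm_nonneg _) (norm_fst_le z) 2

lemma snd_sq_le (z : ℝ × ℝ) : z.2 ^ 2 ≤ ‖z‖ ^ 2 := by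
  rw [← sq_abs, ← Real.norm_eq_abs]
  exact pow_le_pow_left₀ (norm_nonneg _) (norm_snd_le z) 2

lemma hardy (a : ℕ) {f : ℝ × ℝ → ℝ × ℝ} (hf : ContDiff ℝ ∞ f) :
    ∫ x in Oset, qw x ^ a * ‖f x‖ ^ 2
      ≤ 4 * (4 * a + 6) ^ 2 * ((∫ x in Oset, qw x ^ (a + 2) * ‖f x‖ ^ 2)
          + ∫ x in Oset, qw x ^ (a + 2) * ‖pd2 f x‖ ^ 2) := by
  have hq := qw_cont
  have cf := hf.continuous
  have cg := (sm_pd2 hf).continuous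
  have hd : ∀ s b : ℝ, HasDerivAt (fun y => f (s, y)) (pd2 f (s, b)) b := by
    intro s b
    have h1 : HasFDerivAt f (fderiv ℝ f (s, b)) (s, b) :=
      (hf.differentiable (by simp) _).hasFDerivAt
    exact h1.comp_hasDerivAt b ((hasDerivAt_const b s).prodMk (hasDerivAt_id b))
  have H1 := hardy_real a (f := fun x => (f x).1) (f' := fun x => (pd2 f x).1)
    (by fun_prop) (by fun_prop)
    (fun s b => by
      have h := ((ContinuousLinearMap.fst ℝ ℝ ℝ).hasFDerivAt (x := f (s, b))).comp_hasDerivAt b (hd s b)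
      exact h)
  have H2 := hardy_real a (f := fun x => (f x).2) (f' := fun x => (pd2 f x).2)
    (by fun_prop) (by fun_prop)
    (fun s b => by
      have h := ((ContinuousLinearMap.snd ℝ ℝ ℝ).hasFDerivAt (x := f (s, b))).comp_hasDerivAt b (hd s b)
      exact h)
  have e1 : ∫ x in Oset, qw x ^ a * ‖f x‖ ^ 2 ≤
      (∫ x in Oset, qw x ^ a * (f x).1 ^ 2) + ∫ x in Oset, qw x ^ a * (f x).2 ^ 2 := by
    rw [← integral_add (intO (by fun_prop)) (intO (by fun_prop))]
    refine int_mono (by fun_prop) (by fun_prop) fun x hx => ?_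
    rw [← mul_add]
    exact mul_le_mul_of_nonneg_left (norm_sq_le_prod _) (pow_nonneg (qw_nonneg hx) a)
  have e2 : ∀ F : ℝ × ℝ → ℝ, Continuous F → ∀ G : ℝ × ℝ → ℝ, Continuous G →
      (∀ x, F x ^ 2 ≤ ‖f x‖ ^ 2) → (∀ x, G x ^ 2 ≤ ‖pd2 f x‖ ^ 2) →
      ∫ x in Oset, qw x ^ (a + 2) * (F x ^ 2 + G x ^ 2) ≤
        (∫ x in Oset, qw x ^ (a + 2) * ‖f x‖ ^ 2)
          + ∫ x in Oset, qw x ^ (a + 2) * ‖pd2 f x‖ ^ 2 := by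
    intro F hF G hG h1 h2
    rw [← integral_add (intO (by fun_prop)) (intO (by fun_prop))]
    refine int_mono (by fun_prop) (by fun_prop) fun x hx => ?_
    rw [← mul_add]
    exact mul_le_mul_of_nonneg_left (add_le_add (h1 x) (h2 x)) (pow_nonneg (qw_nonneg hx) _)
  have E1 := e2 (fun x => (f x).1) (by fun_prop) (fun x => (pd2 f x).1) (by fun_prop)
    (fun x => fst_sq_le _) (fun x => fst_sq_le _)
  have E2 := e2 (fun x => (f x).2) (by fun_prop) (fun x => (pd2 f x).2) (by fun_prop)
    (fun x => snd_sq_le _) (fun x => snd_sq_le _)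
  have hc : (0:ℝ) ≤ 2 * (4 * a + 6) ^ 2 := by positivity
  have E1' := mul_le_mul_of_nonneg_left E1 hc
  have E2' := mul_le_mul_of_nonneg_left E2 hc
  linarith

/-! ### The reduced family of weighted norms -/

/-- All the weighted norms controlled directly by the energy are bounded by `K`. -/
def Ctrl (f : ℝ × ℝ → ℝ × ℝ) (K : ℝ) : Prop :=
  ∀ i m : ℕ, 2 ≤ i + m → i + m ≤ 8 →
    ∫ x in Oset, qw x ^ (max m 1) * ‖pd1^[i] (pd2^[m] f) x‖ ^ 2 ≤ K

lemma ctrl_iter (j : ℕ) : ∀ a : ℕ, ∃ C : ℝ, 0 < C ∧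
    ∀ (f : ℝ × ℝ → ℝ × ℝ) (K : ℝ), ContDiff ℝ ∞ f → Ctrl f K → ∀ i m : ℕ, 2 ≤ i + m →
      i + m + j ≤ 8 → max m 1 ≤ a + j →
      ∫ x in Oset, qw x ^ a * ‖pd1^[i] (pd2^[m] f) x‖ ^ 2 ≤ C * K := by
  induction j with
  | zero =>
    intro a
    refine ⟨1, one_pos, fun f K hf hK i m h2 h8 hm => ?_⟩
    rw [one_mul]
    have hq := qw_cont
    have hc := (sm_mixed hf i m).continuous
    refine le_trans ?_ (hK i m h2 (by omega))
    refine int_mono (by fun_prop) (by fun_prop) fun x hx => ?_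
    exact mul_le_mul_of_nonneg_right
      (pow_le_pow_of_le_one (qw_nonneg hx) (qw_le_one hx) hm) (sq_nonneg _)
  | succ j ih =>
    intro a
    obtain ⟨C, hC, h⟩ := ih (a + 2)
    refine ⟨4 * (4 * a + 6) ^ 2 * (C + C), by positivity, fun f K hf hK i m h2 h8 hm => ?_⟩
    have H := hardy a (sm_mixed hf i m)
    rw [pd2_mixed hf] at H
    have H1 := h f K hf hK i m h2 (by omega) (by omega)
    have H2 := h f K hf hK i (m + 1) (by omega) (by omega) (by omega)
    refine H.trans ?_
    have := mul_le_mul_of_nonneg_left (add_le_add H1 H2)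
      (show (0:ℝ) ≤ 4 * (4 * a + 6) ^ 2 by positivity)
    refine this.trans (le_of_eq ?_)
    ring

/-- The weighted tensor norms are controlled. -/
lemma ctrl_wL2 (C₁ C₂ : ℝ) (hC₁ : 0 < C₁) (hC₁₂ : C₁ ≤ C₂) (p k l : ℕ) :
    ∃ C : ℝ, 0 < C ∧ (2 ≤ k → 2 * k + l ≤ 8 + 2 * p → k + l ≤ 8 →
      ∀ ρ₀ : ℝ × ℝ → ℝ, IsDensity C₁ C₂ ρ₀ → ∀ (f : ℝ × ℝ → ℝ × ℝ) (K : ℝ),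
        ContDiff ℝ ∞ f → Ctrl f K → wL2 ρ₀ p k l f ≤ C * √K) := by
  obtain ⟨C, hC, h⟩ := ctrl_iter (8 - (k + l)) (2 * p)
  set A : ℝ := (2 * C₂) ^ (2 * p) * (4 ^ k * (k + 1)) with hA
  have hC₂ : 0 < C₂ := lt_of_lt_of_le hC₁ hC₁₂
  have hA0 : 0 < A := by rw [hA]; positivity
  refine ⟨√(A * ((k + 1) * C)), by positivity, ?_⟩
  intro hk hkl hkl8 ρ₀ hρ f K hf hK
  rw [← Real.sqrt_mul (by positivity)]
  unfold wL2
  apply Real.sqrt_le_sqrt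
  have hρc : Continuous ρ₀ := (hρ.1 0).continuous
  have hq := qw_cont
  have hc : ∀ i m, Continuous (pd1^[i] (pd2^[m] f)) := fun i m => (sm_mixed hf i m).continuous
  have hit : Continuous (fun x => iteratedFDeriv ℝ k (pd1^[l] f) x) :=
    (sm_pd1_it hf l).continuous_iteratedFDeriv (m := k) (by exact_mod_cast le_top)
  have step : ∫ x in Oset, (ρ₀ x ^ p * ‖iteratedFDeriv ℝ k (pd1^[l] f) x‖) ^ 2 ≤
      ∫ x in Oset, A * ∑ m ∈ Finset.range (k + 1),
        qw x ^ (2 * p) * ‖pd1^[l + (k - m)] (pd2^[m] f) x‖ ^ 2 := by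
    refine int_mono (by fun_prop) (by fun_prop) fun x hx => ?_
    obtain ⟨h1, h2⟩ := hρ.2.2.2 x hx
    have hd0 : 0 ≤ distG x := (qw_nonneg hx).trans (qw_le_dist hx)
    have hρ0 : 0 ≤ ρ₀ x := (mul_nonneg hC₁.le hd0).trans h1
    have hρq : ρ₀ x ≤ 2 * C₂ * qw x := by
      have := mul_le_mul_of_nonneg_left (dist_le_qw hx) hC₂.le
      linarith
    have hp : ρ₀ x ^ (2 * p) ≤ (2 * C₂) ^ (2 * p) * qw x ^ (2 * p) := by
      rw [← mul_pow]; exact pow_le_pow_left₀ hρ0 hρq _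
    rw [mul_pow, ← pow_mul, mul_comm p 2, ← Finset.mul_sum]
    refine (mul_le_mul hp (norm_iter_sq_le hf x k l) (sq_nonneg _)
      (mul_nonneg (by positivity) (pow_nonneg (qw_nonneg hx) _))).trans (le_of_eq ?_)
    rw [hA]; ring
  refine step.trans ?_
  rw [integral_const_mul, integral_finsetSum _ (fun m _ => intO (by fun_prop))]
  rw [mul_assoc A]
  refine mul_le_mul_of_nonneg_left ?_ hA0.le
  have : ∑ m ∈ Finset.range (k + 1), ∫ x in Oset,
      qw x ^ (2 * p) * ‖pd1^[l + (k - m)] (pd2^[m] f) x‖ ^ 2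
      ≤ ∑ m ∈ Finset.range (k + 1), C * K := by
    refine Finset.sum_le_sum fun m hm => ?_
    have := Finset.mem_range.1 hm
    exact h f K hf hK _ _ (by omega) (by omega) (by omega)
  refine this.trans (le_of_eq ?_)
  rw [Finset.sum_const, Finset.card_range, nsmul_eq_mul]
  push_cast; ring

/-! ### The energy controls the reduced family -/

lemma rho_nonneg {C₁ C₂ : ℝ} (hC₁ : 0 < C₁) {ρ₀ : ℝ × ℝ → ℝ} (hρ : IsDensity C₁ C₂ ρ₀)
    {x : ℝ × ℝ} (hx : x ∈ Oset) : 0 ≤ ρ₀ x :=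
  (mul_nonneg hC₁.le ((qw_nonneg hx).trans (qw_le_dist hx))).trans (hρ.2.2.2 x hx).1

lemma qw_pow_le {C₁ C₂ : ℝ} (hC₁ : 0 < C₁) {ρ₀ : ℝ × ℝ → ℝ} (hρ : IsDensity C₁ C₂ ρ₀)
    {x : ℝ × ℝ} (hx : x ∈ Oset) {j : ℕ} (hj : j ≤ 8) :
    qw x ^ j ≤ (1 + 1 / C₁) ^ 8 * ρ₀ x ^ j := by
  have hρ0 := rho_nonneg hC₁ hρ hx
  have h1 := (hρ.2.2.2 x hx).1
  have h2 : qw x ≤ (1 + 1 / C₁) * ρ₀ x := by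
    have h3 : distG x ≤ 1 / C₁ * ρ₀ x := by
      rw [one_div, inv_mul_eq_div, le_div_iff₀ hC₁]; linarith
    have := qw_le_dist hx
    linarith
  have h4 : (1:ℝ) ≤ 1 + 1 / C₁ := by
    have : 0 < 1 / C₁ := by positivity
    linarith
  refine (pow_le_pow_left₀ (qw_nonneg hx) h2 j).trans ?_
  rw [mul_pow]
  exact mul_le_mul_of_nonneg_right (pow_le_pow_right₀ h4 hj) (pow_nonneg hρ0 _)

lemma gradSq_nonneg (f : ℝ × ℝ → ℝ × ℝ) (x : ℝ × ℝ) : 0 ≤ gradSq f x := by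
  unfold gradSq; positivity

lemma energy_parts {C₁ C₂ : ℝ} (hC₁ : 0 < C₁) {ρ₀ : ℝ × ℝ → ℝ} (hρ : IsDensity C₁ C₂ ρ₀)
    (v : ℝ → ℝ × ℝ → ℝ × ℝ) (t : ℝ) :
    (∀ l ≤ 6, ∫ x in Oset, ρ₀ x * (gradSq (pd1^[l] (v t)) x + gradSq (pd1^[l + 1] (v t)) x)
      ≤ energy ρ₀ v t) ∧
    (∀ l m, 2 ≤ m → l + m ≤ 8 →
      ∫ x in Oset, ρ₀ x ^ m * ‖(pd1^[l] (pd2^[m] (v t))) x‖ ^ 2 ≤ energy ρ₀ v t) := by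
  have n1 : 0 ≤ ∑ l₀ ∈ Finset.range 5, ∫ x in Oset, ρ₀ x * ‖(pdt^[l₀] v) t x‖ ^ 2 :=
    Finset.sum_nonneg fun l _ => int_nonneg fun x hx =>
      mul_nonneg (rho_nonneg hC₁ hρ hx) (sq_nonneg _)
  have n2 : ∀ l₀ l₁ : ℕ, 0 ≤ ∫ x in Oset, ρ₀ x *
      (gradSq (pd1^[l₁] ((pdt^[l₀] v) t)) x + gradSq (pd1^[l₁ + 1] ((pdt^[l₀] v) t)) x) :=
    fun l₀ l₁ => int_nonneg fun x hx => mul_nonneg (rho_nonneg hC₁ hρ hx)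
      (add_nonneg (gradSq_nonneg _ _) (gradSq_nonneg _ _))
  have n3 : ∀ l₀ l₁ l₂ : ℕ, 0 ≤ ∫ x in Oset,
      ρ₀ x ^ l₂ * ‖(pd1^[l₁] (pd2^[l₂] ((pdt^[l₀] v) t))) x‖ ^ 2 :=
    fun l₀ l₁ l₂ => int_nonneg fun x hx =>
      mul_nonneg (pow_nonneg (rho_nonneg hC₁ hρ hx) _) (sq_nonneg _)
  have N2 : ∀ l₀, 0 ≤ ∑ l₁ ∈ Finset.range (7 - 2 * l₀), ∫ x in Oset, ρ₀ x *
      (gradSq (pd1^[l₁] ((pdt^[l₀] v) t)) x + gradSq (pd1^[l₁ + 1] ((pdt^[l₀] v) t)) x) :=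
    fun l₀ => Finset.sum_nonneg fun l₁ _ => n2 l₀ l₁
  have N3 : ∀ l₀ l₁, 0 ≤ ∑ l₂ ∈ Finset.Icc 2 (8 - 2 * l₀ - l₁),
      ∫ x in Oset, ρ₀ x ^ l₂ * ‖(pd1^[l₁] (pd2^[l₂] ((pdt^[l₀] v) t))) x‖ ^ 2 :=
    fun l₀ l₁ => Finset.sum_nonneg fun l₂ _ => n3 l₀ l₁ l₂
  have N3' : ∀ l₀, 0 ≤ ∑ l₁ ∈ Finset.range (7 - 2 * l₀),
      ∑ l₂ ∈ Finset.Icc 2 (8 - 2 * l₀ - l₁),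
      ∫ x in Oset, ρ₀ x ^ l₂ * ‖(pd1^[l₁] (pd2^[l₂] ((pdt^[l₀] v) t))) x‖ ^ 2 :=
    fun l₀ => Finset.sum_nonneg fun l₁ _ => N3 l₀ l₁
  have M2 := Finset.sum_nonneg (s := Finset.range 4) fun l₀ _ => N2 l₀
  have M3 := Finset.sum_nonneg (s := Finset.range 4) fun l₀ _ => N3' l₀
  constructor
  · intro l hl
    have a1 := Finset.single_le_sum (s := Finset.range 4) (fun l₀ _ => N2 l₀)
      (Finset.mem_range.2 (show 0 < 4 by norm_num))
    have a2 := Finset.single_le_sum (s := Finset.range (7 - 2 * 0)) (fun l₁ _ => n2 0 l₁)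
      (Finset.mem_range.2 (show l < 7 - 2 * 0 by omega))
    have a3 := a2.trans a1
    unfold energy
    refine le_trans a3 ?_
    linarith
  · intro l m hm hlm
    have a1 := Finset.single_le_sum (s := Finset.range 4) (fun l₀ _ => N3' l₀)
      (Finset.mem_range.2 (show 0 < 4 by norm_num))
    have a2 := Finset.single_le_sum (s := Finset.range (7 - 2 * 0)) (fun l₁ _ => N3 0 l₁)
      (Finset.mem_range.2 (show l < 7 - 2 * 0 by omega))
    have a3 := Finset.single_le_sum (s := Finset.Icc 2 (8 - 2 * 0 - l)) (fun l₂ _ => n3 0 l l₂)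
      (Finset.mem_Icc.2 (show 2 ≤ m ∧ m ≤ 8 - 2 * 0 - l by omega))
    have a4 := (a3.trans a2).trans a1
    unfold energy
    refine le_trans a4 ?_
    linarith

lemma ctrl_energy {C₁ C₂ : ℝ} (hC₁ : 0 < C₁) {ρ₀ : ℝ × ℝ → ℝ} (hρ : IsDensity C₁ C₂ ρ₀)
    (v : ℝ → ℝ × ℝ → ℝ × ℝ) (t : ℝ) (hv : ContDiff ℝ ∞ (v t)) :
    Ctrl (v t) ((1 + 1 / C₁) ^ 8 * energy ρ₀ v t) := by
  obtain ⟨P1, P2⟩ := energy_parts hC₁ hρ v t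
  have hρc : Continuous ρ₀ := (hρ.1 0).continuous
  have hq := qw_cont
  have hc : ∀ i m, Continuous (pd1^[i] (pd2^[m] (v t))) :=
    fun i m => (sm_mixed hv i m).continuous
  have hc1 : ∀ i, Continuous (pd1^[i] (v t)) := fun i => (sm_pd1_it hv i).continuous
  have hg : ∀ l, Continuous (gradSq (pd1^[l] (v t))) := by
    intro l
    have h1 := (sm_pd1 (sm_pd1_it hv l)).continuous
    have h2 := (sm_pd2 (sm_pd1_it hv l)).continuous
    unfold gradSq
    fun_prop
  intro i m h2 h8
  have hA : (0:ℝ) ≤ (1 + 1 / C₁) ^ 8 := by positivity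
  have red : ∀ G : ℝ × ℝ → ℝ, Continuous G → ∫ x in Oset, G x ≤ energy ρ₀ v t →
      (∀ x ∈ Oset, ρ₀ x ^ (max m 1) * ‖pd1^[i] (pd2^[m] (v t)) x‖ ^ 2 ≤ G x) →
      ∫ x in Oset, qw x ^ (max m 1) * ‖pd1^[i] (pd2^[m] (v t)) x‖ ^ 2
        ≤ (1 + 1 / C₁) ^ 8 * energy ρ₀ v t := by
    intro G hG hGe hle
    refine le_trans ?_ (mul_le_mul_of_nonneg_left hGe hA)
    rw [← integral_const_mul]
    refine int_mono (by have := hc i m; fun_prop) (by fun_prop) fun x hx => ?_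
    have h1 := qw_pow_le hC₁ hρ hx (show max m 1 ≤ 8 by omega)
    have h3 := mul_le_mul_of_nonneg_right h1 (sq_nonneg ‖pd1^[i] (pd2^[m] (v t)) x‖)
    have h4 := mul_le_mul_of_nonneg_left (hle x hx) hA
    linarith
  rcases Nat.lt_or_ge m 2 with hm | hm
  · obtain rfl | rfl : m = 0 ∨ m = 1 := by omega
    · obtain ⟨l, rfl⟩ : ∃ l, i = l + 2 := ⟨i - 2, by omega⟩
      refine red (fun x => ρ₀ x * (gradSq (pd1^[l] (v t)) x + gradSq (pd1^[l + 1] (v t)) x))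
        (hρc.mul ((hg l).add (hg (l + 1)))) (P1 l (by omega)) fun x hx => ?_
      have h0 := rho_nonneg hC₁ hρ hx
      have e : ‖pd1^[l + 2] (v t) x‖ ^ 2 ≤ gradSq (pd1^[l + 1] (v t)) x := by
        unfold gradSq
        rw [← Function.iterate_succ_apply' pd1 (l + 1)]
        nlinarith [sq_nonneg ‖pd2 (pd1^[l + 1] (v t)) x‖]
      have e2 := gradSq_nonneg (pd1^[l] (v t)) x
      simp only [Function.iterate_zero, id_eq, zero_le, sup_of_le_right, pow_one]
      exact mul_le_mul_of_nonneg_left (by linarith) h0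
    · obtain ⟨l, rfl⟩ : ∃ l, i = l + 1 := ⟨i - 1, by omega⟩
      refine red (fun x => ρ₀ x * (gradSq (pd1^[l] (v t)) x + gradSq (pd1^[l + 1] (v t)) x))
        (hρc.mul ((hg l).add (hg (l + 1)))) (P1 l (by omega)) fun x hx => ?_
      have h0 := rho_nonneg hC₁ hρ hx
      have e : ‖pd1^[l + 1] (pd2 (v t)) x‖ ^ 2 ≤ gradSq (pd1^[l + 1] (v t)) x := by
        unfold gradSq
        rw [pd2_pd1_it hv]
        nlinarith [sq_nonneg ‖pd1 (pd1^[l + 1] (v t)) x‖]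
      have e2 := gradSq_nonneg (pd1^[l] (v t)) x
      simp only [Function.iterate_one, max_self, pow_one]
      exact mul_le_mul_of_nonneg_left (by linarith) h0
  · refine red (fun x => ρ₀ x ^ m * ‖pd1^[i] (pd2^[m] (v t)) x‖ ^ 2)
      ((hρc.pow m).mul ((hc i m).norm.pow 2)) (P2 i m hm h8) fun x hx => ?_
    rw [max_eq_left (by omega)]

/-! ### Time dependence -/

/-- Joint smoothness. -/
def JS (v : ℝ → ℝ × ℝ → ℝ × ℝ) : Prop :=
  ContDiff ℝ ∞ (fun p : ℝ × (ℝ × ℝ) => v p.1 p.2)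

lemma JS.slice {v : ℝ → ℝ × ℝ → ℝ × ℝ} (hv : JS v) (t : ℝ) : ContDiff ℝ ∞ (v t) := by
  unfold JS at hv
  exact hv.comp (contDiff_const.prodMk contDiff_id)

lemma JS.fd {v : ℝ → ℝ × ℝ → ℝ × ℝ} (hv : JS v) :
    ContDiff ℝ ∞ (fun p : ℝ × (ℝ × ℝ) => fderiv ℝ (v p.1) p.2) := by
  refine ContDiff.fderiv (f := fun (p : ℝ × (ℝ × ℝ)) y => v p.1 y) (g := fun p => p.2)
    (m := ∞) (n := ∞) ?_ contDiff_snd (by simp)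
  unfold JS at hv
  exact hv.comp (f := fun q : (ℝ × (ℝ × ℝ)) × (ℝ × ℝ) => (q.1.1, q.2))
    ((contDiff_fst.comp contDiff_fst).prodMk contDiff_snd)

lemma JS.fdapp {v : ℝ → ℝ × ℝ → ℝ × ℝ} (hv : JS v) (e : ℝ × ℝ) :
    JS (fun s x => fderiv ℝ (v s) x e) :=
  hv.fd.clm_apply contDiff_const

lemma JS.pd1 {v : ℝ → ℝ × ℝ → ℝ × ℝ} (hv : JS v) : JS (fun s => pd1 (v s)) := hv.fdapp _

lemma JS.pd2 {v : ℝ → ℝ × ℝ → ℝ × ℝ} (hv : JS v) : JS (fun s => pd2 (v s)) := hv.fdapp _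

lemma JS.pdt {v : ℝ → ℝ × ℝ → ℝ × ℝ} (hv : JS v) : JS (pdt v) := by
  have h : ContDiff ℝ ∞ (fun p : ℝ × (ℝ × ℝ) => fderiv ℝ (fun s => v s p.2) p.1) := by
    refine ContDiff.fderiv (f := fun (p : ℝ × (ℝ × ℝ)) s => v s p.2) (g := fun p => p.1)
      (m := ∞) (n := ∞) ?_ contDiff_fst (by simp)
    unfold JS at hv
    exact hv.comp (f := fun q : (ℝ × (ℝ × ℝ)) × ℝ => (q.2, q.1.2))
      (contDiff_snd.prodMk (contDiff_snd.comp contDiff_fst))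
  have h2 := h.clm_apply (contDiff_const (c := (1:ℝ)))
  exact h2

lemma JS.pd1_it {v : ℝ → ℝ × ℝ → ℝ × ℝ} (hv : JS v) (i : ℕ) :
    JS (fun s => _root_.pd1^[i] (v s)) := by
  induction i with
  | zero => exact hv
  | succ i ih => simp only [Function.iterate_succ_apply']; exact ih.pd1

lemma JS.pd2_it {v : ℝ → ℝ × ℝ → ℝ × ℝ} (hv : JS v) (i : ℕ) :
    JS (fun s => _root_.pd2^[i] (v s)) := by
  induction i with
  | zero => exact hv
  | succ i ih => simp only [Function.iterate_succ_apply']; exact ih.pd2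

lemma JS.pdt_it {v : ℝ → ℝ × ℝ → ℝ × ℝ} (hv : JS v) (i : ℕ) :
    JS (_root_.pdt^[i] v) := by
  induction i with
  | zero => exact hv
  | succ i ih => rw [Function.iterate_succ_apply']; exact ih.pdt

lemma cont_int {G : ℝ → ℝ × ℝ → ℝ} (hG : Continuous (fun p : ℝ × (ℝ × ℝ) => G p.1 p.2)) :
    Continuous (fun s => ∫ x in Oset, G s x) := by
  have hset : Oset =ᵐ[volume] (Set.Icc (0:ℝ) 1 ×ˢ Set.Icc (0:ℝ) 1) := by
    rw [Measure.volume_eq_prod]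
    exact Measure.set_prod_ae_eq Ioo_ae_eq_Icc Ioo_ae_eq_Icc
  have h := continuous_parametric_integral_of_continuous (μ := (volume : Measure (ℝ × ℝ)))
    (f := G) hG (isCompact_Icc.prod isCompact_Icc :
      IsCompact (Set.Icc (0:ℝ) 1 ×ˢ Set.Icc (0:ℝ) 1))
  refine h.congr fun s => ?_
  exact (setIntegral_congr_set hset).symm

lemma energy_cont {ρ₀ : ℝ × ℝ → ℝ} (hρ : Continuous ρ₀) {v : ℝ → ℝ × ℝ → ℝ × ℝ} (hv : JS v) :
    Continuous (energy ρ₀ v) := by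
  have hr : Continuous (fun p : ℝ × (ℝ × ℝ) => ρ₀ p.2) := hρ.comp continuous_snd
  have hgrad : ∀ u : ℝ → ℝ × ℝ → ℝ × ℝ, JS u →
      Continuous (fun p : ℝ × (ℝ × ℝ) => gradSq (u p.1) p.2) := by
    intro u hu
    have h1 : Continuous (fun p : ℝ × (ℝ × ℝ) => pd1 (u p.1) p.2) := hu.pd1.continuous
    have h2 : Continuous (fun p : ℝ × (ℝ × ℝ) => pd2 (u p.1) p.2) := hu.pd2.continuous
    unfold gradSq
    fun_prop
  unfold energy
  refine Continuous.add (Continuous.add ?_ ?_) ?_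
  · refine continuous_finsetSum _ fun l₀ _ => cont_int ?_
    have h1 : Continuous (fun p : ℝ × (ℝ × ℝ) => (pdt^[l₀] v) p.1 p.2) :=
      (hv.pdt_it l₀).continuous
    fun_prop
  · refine continuous_finsetSum _ fun l₀ _ => continuous_finsetSum _ fun l₁ _ => cont_int ?_
    have h1 := hgrad _ ((hv.pdt_it l₀).pd1_it l₁)
    have h2 := hgrad _ ((hv.pdt_it l₀).pd1_it (l₁ + 1))
    exact hr.mul (h1.add h2)
  · refine continuous_finsetSum _ fun l₀ _ => continuous_finsetSum _ fun l₁ _ =>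
      continuous_finsetSum _ fun l₂ _ => cont_int ?_
    have h1 : Continuous (fun p : ℝ × (ℝ × ℝ) =>
        (pd1^[l₁] (pd2^[l₂] ((pdt^[l₀] v) p.1))) p.2) :=
      (((hv.pdt_it l₀).pd2_it l₂).pd1_it l₁).continuous
    fun_prop

lemma energy_le_sup {ρ₀ : ℝ × ℝ → ℝ} (hρ : Continuous ρ₀) {v : ℝ → ℝ × ℝ → ℝ × ℝ} (hv : JS v)
    {t s : ℝ} (hs : s ∈ Set.Icc (0:ℝ) t) : √(energy ρ₀ v s) ≤ supEn ρ₀ v t := by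
  have hc : Continuous (fun s => √(energy ρ₀ v s)) := (energy_cont hρ hv).sqrt
  have hb := (isCompact_Icc (a := (0:ℝ)) (b := t)).bddAbove_image hc.continuousOn
  unfold supEn
  refine le_ciSup (f := fun s : Set.Icc (0:ℝ) t => √(energy ρ₀ v ↑s)) ?_ ⟨s, hs⟩
  obtain ⟨M, hM⟩ := hb
  refine ⟨M, ?_⟩
  rintro _ ⟨y, rfl⟩
  exact hM ⟨y, y.2, rfl⟩

/-! ### Time integrals -/

lemma hasFD_timeint {v : ℝ → ℝ × ℝ → ℝ × ℝ} (hv : JS v) (t : ℝ) (x : ℝ × ℝ) :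
    HasFDerivAt (fun x => ∫ s in (0:ℝ)..t, v s x) (∫ s in (0:ℝ)..t, fderiv ℝ (v s) x) x := by
  have cv : Continuous (fun p : ℝ × (ℝ × ℝ) => v p.1 p.2) := hv.continuous
  have cd : Continuous (fun p : ℝ × (ℝ × ℝ) => fderiv ℝ (v p.1) p.2) := hv.fd.continuous
  obtain ⟨M, hM⟩ := ((isCompact_uIcc (a := (0:ℝ)) (b := t)).prod
    (isCompact_closedBall x 1)).bddAbove_image cd.norm.continuousOn
  refine intervalIntegral.hasFDerivAt_integral_of_dominated_of_fderiv_le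
    (F := fun x s => v s x) (F' := fun x s => fderiv ℝ (v s) x) (bound := fun _ => M)
    (s := Metric.closedBall x 1) (Metric.closedBall_mem_nhds x one_pos) ?_ ?_ ?_ ?_ ?_ ?_
  · refine Eventually.of_forall fun y => Continuous.aestronglyMeasurable ?_
    exact cv.comp (by fun_prop : Continuous fun s : ℝ => (s, y))
  · refine Continuous.intervalIntegrable ?_ _ _
    exact cv.comp (by fun_prop : Continuous fun s : ℝ => (s, x))
  · refine Continuous.aestronglyMeasurable ?_
    exact cd.comp (by fun_prop : Continuous fun s : ℝ => (s, x))
  · refine Eventually.of_forall fun s hs y hy => ?_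
    exact hM ⟨(s, y), ⟨Set.uIoc_subset_uIcc hs, hy⟩, rfl⟩
  · exact intervalIntegrable_const
  · refine Eventually.of_forall fun s hs y hy => ?_
    exact ((hv.slice s).differentiable (by simp) y).hasFDerivAt

lemma fd_timeint {v : ℝ → ℝ × ℝ → ℝ × ℝ} (hv : JS v) (t : ℝ) (x e : ℝ × ℝ) :
    fderiv ℝ (fun x => ∫ s in (0:ℝ)..t, v s x) x e = ∫ s in (0:ℝ)..t, fderiv ℝ (v s) x e := by
  have cd : Continuous (fun p : ℝ × (ℝ × ℝ) => fderiv ℝ (v p.1) p.2) := hv.fd.continuous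
  rw [(hasFD_timeint hv t x).fderiv]
  refine ContinuousLinearMap.intervalIntegral_apply (Continuous.intervalIntegrable ?_ _ _) e
  exact cd.comp (by fun_prop : Continuous fun s : ℝ => (s, x))

lemma sm_timeint_nat (n : ℕ) : ∀ {v : ℝ → ℝ × ℝ → ℝ × ℝ}, JS v → ∀ t : ℝ,
    ContDiff ℝ n (fun x => ∫ s in (0:ℝ)..t, v s x) := by
  induction n with
  | zero =>
    intro v hv t
    exact contDiff_zero.2 (continuous_iff_continuousAt.2 fun x =>
      (hasFD_timeint hv t x).continuousAt)
  | succ n ih =>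
    intro v hv t
    have : ((n + 1 : ℕ) : WithTop ℕ∞) = (n : WithTop ℕ∞) + 1 := by push_cast; rfl
    rw [this, contDiff_succ_iff_fderiv_apply]
    refine ⟨fun x => (hasFD_timeint hv t x).differentiableAt, by simp, fun e => ?_⟩
    simp only [fd_timeint hv]
    exact ih (hv.fdapp e) t

lemma sm_timeint {v : ℝ → ℝ × ℝ → ℝ × ℝ} (hv : JS v) (t : ℝ) :
    ContDiff ℝ ∞ (fun x => ∫ s in (0:ℝ)..t, v s x) :=
  contDiff_infty.2 fun n => sm_timeint_nat n hv t

lemma pd1_it_timeint {v : ℝ → ℝ × ℝ → ℝ × ℝ} (hv : JS v) (t : ℝ) (i : ℕ) :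
    pd1^[i] (fun x => ∫ s in (0:ℝ)..t, v s x) = fun x => ∫ s in (0:ℝ)..t, pd1^[i] (v s) x := by
  induction i with
  | zero => rfl
  | succ i ih =>
    simp only [Function.iterate_succ_apply']
    rw [ih]
    funext x
    exact fd_timeint (hv.pd1_it i) t x _

lemma pd2_it_timeint {v : ℝ → ℝ × ℝ → ℝ × ℝ} (hv : JS v) (t : ℝ) (i : ℕ) :
    pd2^[i] (fun x => ∫ s in (0:ℝ)..t, v s x) = fun x => ∫ s in (0:ℝ)..t, pd2^[i] (v s) x := by
  induction i with
  | zero => rfl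
  | succ i ih =>
    simp only [Function.iterate_succ_apply']
    rw [ih]
    funext x
    exact fd_timeint (hv.pd2_it i) t x _

lemma pd1_add_it {f g : ℝ × ℝ → ℝ × ℝ} (hf : ContDiff ℝ ∞ f) (hg : ContDiff ℝ ∞ g) (i : ℕ) :
    pd1^[i] (fun x => f x + g x) = fun x => pd1^[i] f x + pd1^[i] g x := by
  induction i with
  | zero => rfl
  | succ i ih =>
    simp only [Function.iterate_succ_apply']
    rw [ih]
    funext x
    show fderiv ℝ (fun x => pd1^[i] f x + pd1^[i] g x) x (1, 0) = _
    rw [fderiv_fun_add ((sm_pd1_it hf i).differentiable (by simp) x)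
      ((sm_pd1_it hg i).differentiable (by simp) x)]
    rfl

lemma pd2_add_it {f g : ℝ × ℝ → ℝ × ℝ} (hf : ContDiff ℝ ∞ f) (hg : ContDiff ℝ ∞ g) (i : ℕ) :
    pd2^[i] (fun x => f x + g x) = fun x => pd2^[i] f x + pd2^[i] g x := by
  induction i with
  | zero => rfl
  | succ i ih =>
    simp only [Function.iterate_succ_apply']
    rw [ih]
    funext x
    show fderiv ℝ (fun x => pd2^[i] f x + pd2^[i] g x) x (0, 1) = _
    rw [fderiv_fun_add ((sm_pd2_it hf i).differentiable (by simp) x)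
      ((sm_pd2_it hg i).differentiable (by simp) x)]
    rfl

lemma pd1_const (c : ℝ × ℝ) : pd1 (fun _ : ℝ × ℝ => c) = fun _ => (0 : ℝ × ℝ) := by
  funext x; simp [pd1]

lemma pd2_const (c : ℝ × ℝ) : pd2 (fun _ : ℝ × ℝ => c) = fun _ => (0 : ℝ × ℝ) := by
  funext x; simp [pd2]

lemma pd1_zero_it (i : ℕ) : pd1^[i] (fun _ : ℝ × ℝ => (0 : ℝ × ℝ)) = fun _ => (0 : ℝ × ℝ) := by
  induction i with
  | zero => rfl
  | succ i ih => rw [Function.iterate_succ_apply', ih, pd1_const]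

lemma pd2_zero_it (i : ℕ) : pd2^[i] (fun _ : ℝ × ℝ => (0 : ℝ × ℝ)) = fun _ => (0 : ℝ × ℝ) := by
  induction i with
  | zero => rfl
  | succ i ih => rw [Function.iterate_succ_apply', ih, pd2_const]

lemma pd1_ident : pd1 (fun x : ℝ × ℝ => x) = fun _ => ((1:ℝ), (0:ℝ)) := by
  funext x; simp [pd1]

lemma pd2_ident : pd2 (fun x : ℝ × ℝ => x) = fun _ => ((0:ℝ), (1:ℝ)) := by
  funext x; simp [pd2]

lemma mixed_ident (i m : ℕ) (h : 2 ≤ i + m) :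
    pd1^[i] (pd2^[m] (fun x : ℝ × ℝ => x)) = fun _ => (0 : ℝ × ℝ) := by
  match m, i, h with
  | 0, i + 2, _ =>
    rw [Function.iterate_zero, id_eq, Function.iterate_succ_apply, Function.iterate_succ_apply,
      pd1_ident, pd1_const, pd1_zero_it]
  | 1, i + 1, _ =>
    rw [Function.iterate_one, pd2_ident, Function.iterate_succ_apply, pd1_const, pd1_zero_it]
  | m + 2, i, _ =>
    rw [Function.iterate_succ_apply, Function.iterate_succ_apply, pd2_ident, pd2_const,
      pd2_zero_it, pd1_zero_it]

lemma mixed_flow {v : ℝ → ℝ × ℝ → ℝ × ℝ} (hv : JS v) (t : ℝ) (i m : ℕ) (h : 2 ≤ i + m)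
    (x : ℝ × ℝ) :
    pd1^[i] (pd2^[m] (flowMap v t)) x = ∫ s in (0:ℝ)..t, pd1^[i] (pd2^[m] (v s)) x := by
  have e : flowMap v t = fun x => x + (fun x => ∫ s in (0:ℝ)..t, v s x) x := rfl
  have hid : ContDiff ℝ ∞ (fun x : ℝ × ℝ => x) := contDiff_id
  rw [e, pd2_add_it hid (sm_timeint hv t),
    pd1_add_it (sm_pd2_it hid m) (sm_pd2_it (sm_timeint hv t) m), mixed_ident i m h,
    pd2_it_timeint hv, pd1_it_timeint (hv.pd2_it m)]
  simp

lemma sm_flow {v : ℝ → ℝ × ℝ → ℝ × ℝ} (hv : JS v) (t : ℝ) : ContDiff ℝ ∞ (flowMap v t) :=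
  contDiff_id.add (sm_timeint hv t)

lemma cs_time {g : ℝ → ℝ × ℝ} (hg : Continuous g) {t : ℝ} (ht : 0 ≤ t) :
    ‖∫ s in (0:ℝ)..t, g s‖ ^ 2 ≤ t * ∫ s in (0:ℝ)..t, ‖g s‖ ^ 2 := by
  rcases ht.eq_or_lt with rfl | ht0
  · simp
  have h1 : ‖∫ s in (0:ℝ)..t, g s‖ ≤ ∫ s in (0:ℝ)..t, ‖g s‖ :=
    intervalIntegral.norm_integral_le_integral_norm ht
  set I := ∫ s in (0:ℝ)..t, ‖g s‖ with hI
  set J := ∫ s in (0:ℝ)..t, ‖g s‖ ^ 2 with hJ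
  have h2 : 0 ≤ ∫ s in (0:ℝ)..t, (t * ‖g s‖ - I) ^ 2 :=
    intervalIntegral.integral_nonneg ht fun s _ => sq_nonneg _
  have h3 : ∫ s in (0:ℝ)..t, (t * ‖g s‖ - I) ^ 2 = t ^ 2 * J - 2 * t * I * I + t * I ^ 2 := by
    have : ∀ s, (t * ‖g s‖ - I) ^ 2 = t ^ 2 * ‖g s‖ ^ 2 - 2 * t * I * ‖g s‖ + I ^ 2 := by
      intro s; ring
    simp only [this]
    rw [intervalIntegral.integral_add, intervalIntegral.integral_sub,
      intervalIntegral.integral_const_mul, intervalIntegral.integral_const_mul,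
      intervalIntegral.integral_const, sub_zero, smul_eq_mul]
    all_goals exact Continuous.intervalIntegrable (by fun_prop) _ _
  rw [h3] at h2
  have h4 : I ^ 2 ≤ t * J := by
    have : 0 ≤ t * (t * J - I ^ 2) := by nlinarith
    have := nonneg_of_mul_nonneg_right this ht0
    linarith
  exact (pow_le_pow_left₀ (norm_nonneg _) h1 2).trans h4

lemma timeint_bound {u : ℝ → ℝ × ℝ → ℝ × ℝ}
    (hu : Continuous (fun p : ℝ × (ℝ × ℝ) => u p.1 p.2)) {t : ℝ} (ht : 0 ≤ t) (a : ℕ) (K : ℝ)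
    (hw : Continuous (fun x => ∫ s in (0:ℝ)..t, u s x))
    (hK : ∀ s ∈ Set.Icc (0:ℝ) t, ∫ x in Oset, qw x ^ a * ‖u s x‖ ^ 2 ≤ K) :
    ∫ x in Oset, qw x ^ a * ‖∫ s in (0:ℝ)..t, u s x‖ ^ 2 ≤ t ^ 2 * K := by
  have hq := qw_cont
  have hH : Continuous (fun p : (ℝ × ℝ) × ℝ => qw p.1 ^ a * ‖u p.2 p.1‖ ^ 2) := by
    have := hu.comp (by fun_prop : Continuous fun p : (ℝ × ℝ) × ℝ => (p.2, p.1))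
    have h2 : Continuous (fun p : (ℝ × ℝ) × ℝ => u p.2 p.1) := this
    fun_prop
  have hswap : ∫ x in Oset, ∫ s in (0:ℝ)..t, qw x ^ a * ‖u s x‖ ^ 2
      = ∫ s in (0:ℝ)..t, ∫ x in Oset, qw x ^ a * ‖u s x‖ ^ 2 := by
    simp only [intervalIntegral.integral_of_le ht]
    refine integral_integral_swap ?_
    rw [Measure.prod_restrict]
    refine (hH.continuousOn.integrableOn_compact
      ((isCompact_Icc.prod isCompact_Icc : IsCompact (Set.Icc (0:ℝ) 1 ×ˢ Set.Icc (0:ℝ) 1)).prod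
        (isCompact_Icc (a := (0:ℝ)) (b := t)))).mono_set ?_
    exact Set.prod_mono (Set.prod_mono Set.Ioo_subset_Icc_self Set.Ioo_subset_Icc_self)
      Set.Ioc_subset_Icc_self
  have hin : Continuous (fun x => ∫ s in (0:ℝ)..t, qw x ^ a * ‖u s x‖ ^ 2) :=
    intervalIntegral.continuous_parametric_intervalIntegral_of_continuous' hH 0 t
  have hout : Continuous (fun s => ∫ x in Oset, qw x ^ a * ‖u s x‖ ^ 2) := by
    refine cont_int (G := fun s x => qw x ^ a * ‖u s x‖ ^ 2) ?_
    fun_prop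
  calc ∫ x in Oset, qw x ^ a * ‖∫ s in (0:ℝ)..t, u s x‖ ^ 2
      ≤ ∫ x in Oset, t * ∫ s in (0:ℝ)..t, qw x ^ a * ‖u s x‖ ^ 2 := by
        refine int_mono (by fun_prop) (by fun_prop) fun x hx => ?_
        rw [intervalIntegral.integral_const_mul]
        have h1 := cs_time (hu.comp (by fun_prop : Continuous fun s : ℝ => (s, x))) ht
        have h2 := mul_le_mul_of_nonneg_left h1 (pow_nonneg (qw_nonneg hx) a)
        refine h2.trans (le_of_eq ?_)
        simp only [Function.comp_apply]
        ring
    _ = t * ∫ s in (0:ℝ)..t, ∫ x in Oset, qw x ^ a * ‖u s x‖ ^ 2 := by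
        rw [integral_const_mul, hswap]
    _ ≤ t * ∫ s in (0:ℝ)..t, K := by
        refine mul_le_mul_of_nonneg_left ?_ ht
        exact intervalIntegral.integral_mono_on ht (hout.intervalIntegrable _ _)
          intervalIntegrable_const hK
    _ = t ^ 2 * K := by
        rw [intervalIntegral.integral_const, smul_eq_mul]; ring

lemma ctrl_flow {v : ℝ → ℝ × ℝ → ℝ × ℝ} (hv : JS v) {t : ℝ} (ht : 0 ≤ t) (K : ℝ)
    (hK : ∀ s ∈ Set.Icc (0:ℝ) t, Ctrl (v s) K) : Ctrl (flowMap v t) (t ^ 2 * K) := by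
  intro i m h2 h8
  have hu : JS (fun s => pd1^[i] (pd2^[m] (v s))) := (hv.pd2_it m).pd1_it i
  simp only [mixed_flow hv t i m h2]
  exact timeint_bound (u := fun s => pd1^[i] (pd2^[m] (v s))) hu.continuous ht _ K
    (sm_timeint hu t).continuous (fun s hs => hK s hs i m h2 h8)

/-- (Weighted `L²` estimates, Lemma 3.2.)
All the listed weighted `L²(Ω)` norms of `v(t)` are bounded by `C E(t,v)^{1/2}`, and
the corresponding norms of the flow map `η(t)` are bounded by `C t sup_{0≤s≤t}E(s,v)^{1/2}`. -/
theorem stmt1 (C₁ C₂ : ℝ) (hC₁ : 0 < C₁) (hC₁₂ : C₁ ≤ C₂) :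
    ∃ C > (0:ℝ),
      ∀ ρ₀ : ℝ × ℝ → ℝ, IsDensity C₁ C₂ ρ₀ →
        ∀ T : ℝ, 0 ≤ T →
          ∀ v : ℝ → ℝ × ℝ → ℝ × ℝ, SmoothT v → PerT v →
            ∀ t ∈ Set.Icc (0:ℝ) T,
              ((∑ l₂ ∈ Finset.range 2,
                    ((∑ l₁ ∈ Finset.range 5, wL2 ρ₀ l₂ (l₂ + 2) l₁ (v t))
                      + ∑ l₁ ∈ Finset.range 3, wL2 ρ₀ l₂ (l₂ + 3) l₁ (v t)))
                  ≤ C * Real.sqrt (energy ρ₀ v t)) ∧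
              ((∑ l₁ ∈ Finset.range 3, wL2 ρ₀ 3 6 l₁ (v t))
                    + (∑ l₂ ∈ Finset.Icc 1 4, wL2 ρ₀ l₂ (l₂ + 4) 0 (v t))
                  ≤ C * Real.sqrt (energy ρ₀ v t)) ∧
              ((∑ l₂ ∈ Finset.range 2,
                    ((∑ l₁ ∈ Finset.range 5, wL2 ρ₀ l₂ (l₂ + 2) l₁ (flowMap v t))
                      + ∑ l₁ ∈ Finset.range 3, wL2 ρ₀ l₂ (l₂ + 3) l₁ (flowMap v t)))
                  ≤ C * t * supEn ρ₀ v t) ∧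
              ((∑ l₁ ∈ Finset.range 3, wL2 ρ₀ 3 6 l₁ (flowMap v t))
                    + (∑ l₂ ∈ Finset.Icc 1 4, wL2 ρ₀ l₂ (l₂ + 4) 0 (flowMap v t))
                  ≤ C * t * supEn ρ₀ v t) := by
  choose Cst hCst hW using ctrl_wL2 C₁ C₂ hC₁ hC₁₂
  set A1 : ℝ := ∑ l₂ ∈ Finset.range 2, ((∑ l₁ ∈ Finset.range 5, Cst l₂ (l₂ + 2) l₁)
    + ∑ l₁ ∈ Finset.range 3, Cst l₂ (l₂ + 3) l₁) with hA1
  set A2 : ℝ := (∑ l₁ ∈ Finset.range 3, Cst 3 6 l₁) + ∑ l₂ ∈ Finset.Icc 1 4, Cst l₂ (l₂ + 4) 0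
    with hA2
  have A1n : 0 ≤ A1 := Finset.sum_nonneg fun _ _ => add_nonneg
    (Finset.sum_nonneg fun _ _ => (hCst _ _ _).le) (Finset.sum_nonneg fun _ _ => (hCst _ _ _).le)
  have A2n : 0 ≤ A2 := add_nonneg
    (Finset.sum_nonneg fun _ _ => (hCst _ _ _).le) (Finset.sum_nonneg fun _ _ => (hCst _ _ _).le)
  set c0 : ℝ := (1 + 1 / C₁) ^ 8 with hc0
  have hc0p : 0 < c0 := by rw [hc0]; positivity
  refine ⟨(A1 + A2 + 1) * √c0, by positivity, ?_⟩
  intro ρ₀ hρ T _ v hvs _ t ht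
  have hv : JS v := contDiff_infty.2 hvs
  have hρc : Continuous ρ₀ := (hρ.1 0).continuous
  -- the two families of sums, for an arbitrary controlled function
  have S1 : ∀ f K, ContDiff ℝ ∞ f → Ctrl f K →
      (∑ l₂ ∈ Finset.range 2, ((∑ l₁ ∈ Finset.range 5, wL2 ρ₀ l₂ (l₂ + 2) l₁ f)
        + ∑ l₁ ∈ Finset.range 3, wL2 ρ₀ l₂ (l₂ + 3) l₁ f)) ≤ (A1 + A2 + 1) * √K := by
    intro f K hf hK
    have : (∑ l₂ ∈ Finset.range 2, ((∑ l₁ ∈ Finset.range 5, wL2 ρ₀ l₂ (l₂ + 2) l₁ f)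
        + ∑ l₁ ∈ Finset.range 3, wL2 ρ₀ l₂ (l₂ + 3) l₁ f)) ≤ A1 * √K := by
      rw [hA1, Finset.sum_mul]
      refine Finset.sum_le_sum fun l₂ h2 => ?_
      have h2' := Finset.mem_range.1 h2
      rw [add_mul, Finset.sum_mul, Finset.sum_mul]
      refine add_le_add (Finset.sum_le_sum fun l₁ h1 => ?_) (Finset.sum_le_sum fun l₁ h1 => ?_)
      · have h1' := Finset.mem_range.1 h1
        exact hW _ _ _ (by omega) (by omega) (by omega) ρ₀ hρ f K hf hK
      · have h1' := Finset.mem_range.1 h1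
        exact hW _ _ _ (by omega) (by omega) (by omega) ρ₀ hρ f K hf hK
    refine this.trans (mul_le_mul_of_nonneg_right (by linarith) (Real.sqrt_nonneg _))
  have S2 : ∀ f K, ContDiff ℝ ∞ f → Ctrl f K →
      (∑ l₁ ∈ Finset.range 3, wL2 ρ₀ 3 6 l₁ f)
        + (∑ l₂ ∈ Finset.Icc 1 4, wL2 ρ₀ l₂ (l₂ + 4) 0 f) ≤ (A1 + A2 + 1) * √K := by
    intro f K hf hK
    have : (∑ l₁ ∈ Finset.range 3, wL2 ρ₀ 3 6 l₁ f)
        + (∑ l₂ ∈ Finset.Icc 1 4, wL2 ρ₀ l₂ (l₂ + 4) 0 f) ≤ A2 * √K := by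
      rw [hA2, add_mul, Finset.sum_mul, Finset.sum_mul]
      refine add_le_add (Finset.sum_le_sum fun l₁ h1 => ?_) (Finset.sum_le_sum fun l₁ h1 => ?_)
      · have h1' := Finset.mem_range.1 h1
        exact hW _ _ _ (by omega) (by omega) (by omega) ρ₀ hρ f K hf hK
      · have h1' := Finset.mem_Icc.1 h1
        exact hW _ _ _ (by omega) (by omega) (by omega) ρ₀ hρ f K hf hK
    refine this.trans (mul_le_mul_of_nonneg_right (by linarith) (Real.sqrt_nonneg _))
  have E1 : ∀ s, Ctrl (v s) (c0 * energy ρ₀ v s) := fun s => ctrl_energy hC₁ hρ v s (hv.slice s)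
  have hsup0 : 0 ≤ supEn ρ₀ v t :=
    (Real.sqrt_nonneg _).trans (energy_le_sup hρc hv (Set.right_mem_Icc.2 ht.1))
  have E2 : Ctrl (flowMap v t) (t ^ 2 * (c0 * supEn ρ₀ v t ^ 2)) := by
    refine ctrl_flow hv ht.1 _ fun s hs i m h2 h8 => ?_
    refine (E1 s i m h2 h8).trans (mul_le_mul_of_nonneg_left ?_ hc0p.le)
    exact (Real.sqrt_le_left hsup0).1 (energy_le_sup hρc hv hs)
  have q1 : √(c0 * energy ρ₀ v t) = √c0 * √(energy ρ₀ v t) := Real.sqrt_mul hc0p.le _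
  have q2 : √(t ^ 2 * (c0 * supEn ρ₀ v t ^ 2)) = √c0 * t * supEn ρ₀ v t := by
    rw [Real.sqrt_mul (sq_nonneg t), Real.sqrt_mul hc0p.le, Real.sqrt_sq ht.1,
      Real.sqrt_sq hsup0]
    ring
  refine ⟨?_, ?_, ?_, ?_⟩
  · have := S1 _ _ (hv.slice t) (E1 t)
    rw [q1] at this
    linarith
  · have := S2 _ _ (hv.slice t) (E1 t)
    rw [q1] at this
    linarith
  · have := S1 _ _ (sm_flow hv t) E2
    rw [q2] at this
    linarith
  · have := S2 _ _ (sm_flow hv t) E2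
    rw [q2] at this
    linarith
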